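/- arXiv:math/0009112 — 3 statements merged into one kernel-verified Lean document; each statement's English description precedes it below -/
import Mathlib

section
/- Let n ≤ 5. Every Schubert problem for S_n is either dc-equivalent to a dc-trivial Schubert problem or dc-equivalent to (id, id, w₀). -/
/- Background definitions: descent-cycling for Schubert problems on S_n,
   with permutations modeled as `Equiv.Perm (Fin n)` (0-indexed positions:
   position i here corresponds to position i+1 in 1-indexed notation). -/

namespace DC

/-- A triple of permutations of {1,…,n}. -/
abbrev Triple (n : ℕ) := Equiv.Perm (Fin n) × Equiv.Perm (Fin n) × Equiv.Perm (Fin n)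

/-- The length ℓ(π) = number of inversions of π. -/
def len {n : ℕ} (π : Equiv.Perm (Fin n)) : ℕ :=
  (Finset.univ.filter (fun p : Fin n × Fin n => p.1 < p.2 ∧ π p.2 < π p.1)).card

/-- π has a descent at (0-indexed) position i, i.e. π(i) > π(i+1). -/
def Descent {n : ℕ} (π : Equiv.Perm (Fin n)) (i : ℕ) : Prop :=
  ∃ h : i + 1 < n, π ⟨i + 1, h⟩ < π ⟨i, Nat.lt_of_succ_lt h⟩

/-- π has an ascent at (0-indexed) position i, i.e. π(i) < π(i+1). -/
def Ascent {n : ℕ} (π : Equiv.Perm (Fin n)) (i : ℕ) : Prop :=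
  ∃ h : i + 1 < n, π ⟨i, Nat.lt_of_succ_lt h⟩ < π ⟨i + 1, h⟩

/-- The adjacent transposition s_i swapping (0-indexed) i and i+1. -/
def s (n i : ℕ) : Equiv.Perm (Fin n) :=
  if h : i + 1 < n then Equiv.swap ⟨i, Nat.lt_of_succ_lt h⟩ ⟨i + 1, h⟩ else 1

/-- The longest permutation w₀ : m ↦ n+1−m (0-indexed: m ↦ n−1−m). -/
def w0 (n : ℕ) : Equiv.Perm (Fin n) := Fin.revPerm

/-- The complement π̄ = w₀ ∘ π of a permutation. -/
def compl {n : ℕ} (π : Equiv.Perm (Fin n)) : Equiv.Perm (Fin n) := w0 n * π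

/-- A Schubert problem: a triple of permutations whose lengths sum to n(n−1)/2. -/
def IsSchubert {n : ℕ} (P : Triple n) : Prop :=
  len P.1 + len P.2.1 + len P.2.2 = n.choose 2

/-- A Schubert problem is dc-trivial if at some position all three permutations ascend. -/
def DCTrivial {n : ℕ} (P : Triple n) : Prop :=
  IsSchubert P ∧ ∃ i : ℕ, Ascent P.1 i ∧ Ascent P.2.1 i ∧ Ascent P.2.2 i

/-- The three Schubert problems obtainable from (u,v,w) by adding a descent at i. -/
def MoveSet {n : ℕ} (u v w : Equiv.Perm (Fin n)) (i : ℕ) : Set (Triple n) :=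
  {(u * s n i, v, w), (u, v * s n i, w), (u, v, w * s n i)}

/-- P and P′ are joined by a single descent-cycling move. -/
def DCMove {n : ℕ} (P P' : Triple n) : Prop :=
  ∃ (u v w : Equiv.Perm (Fin n)) (i : ℕ),
    len u + len v + len w + 1 = n.choose 2 ∧
    Ascent u i ∧ Ascent v i ∧ Ascent w i ∧
    P ∈ MoveSet u v w i ∧ P' ∈ MoveSet u v w i

/-- dc-equivalence: the reflexive–transitive closure of descent-cycling moves. -/
def DCEquiv {n : ℕ} : Triple n → Triple n → Prop := Relation.ReflTransGen DCMove

/-- An admissible functional on triples of permutations: constant on dc-equivalence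
classes of Schubert problems, zero on dc-trivial Schubert problems, one on (id,id,w₀). -/
def Admissible {n : ℕ} (f : Triple n → ℤ) : Prop :=
  (∀ P P' : Triple n, IsSchubert P → IsSchubert P' → DCEquiv P P' → f P = f P') ∧
  (∀ P : Triple n, DCTrivial P → f P = 0) ∧
  f (1, 1, w0 n) = 1

end DC

namespace DC

/-! ### Permutations as words

Recursive functions on words are defined by recursors, which the kernel evaluates much faster than
definitions compiled from structural recursion. -/

/-- The number of inversions of a word. -/
def inversions : List ℕ → ℕ
  | [] => 0
  | a :: l => l.countP (· < a) + inversions l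

/-- Swap the letters of a word at positions `i` and `i + 1`. -/
def swapAt (i : ℕ) : List ℕ → List ℕ :=
  i.rec
    (fun
      | a :: b :: l => b :: a :: l
      | l => l)
    (fun _ swapTail => fun
      | a :: l => a :: swapTail l
      | [] => [])

/-- The letters of a word at positions `i` and `i + 1`, in this order, are related by `r`. -/
def compareAt (r : ℕ → ℕ → Bool) (i : ℕ) : List ℕ → Bool :=
  i.rec
    (fun
      | a :: b :: _ => r a b
      | _ => false)
    (fun _ compareTail => fun
      | _ :: l => compareTail l
      | [] => false)

/-- The word `l` ascends from position `i` to position `i + 1`. -/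
def ascends (i : ℕ) (l : List ℕ) : Bool := compareAt (fun a b => Nat.blt a b) i l

/-- The word `l` descends from position `i` to position `i + 1`. -/
def descends (i : ℕ) (l : List ℕ) : Bool := compareAt (fun a b => Nat.blt b a) i l

/-- A triple of words. -/
abbrev WordTriple := List ℕ × List ℕ × List ℕ

/-- A descent-cycling move at position `i`, passing on the only descent there; `b` selects which
of the other two words receives it. -/
def cycleAt (i : ℕ) (b : Bool) : WordTriple → Option WordTriple
  | (u, v, w) =>
    bif descends i u && (ascends i v && ascends i w) then
      some (swapAt i u, bif b then (v, swapAt i w) else (swapAt i v, w))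
    else bif ascends i u && (descends i v && ascends i w) then
      some (bif b then (u, swapAt i v, swapAt i w) else (swapAt i u, swapAt i v, w))
    else bif ascends i u && (ascends i v && descends i w) then
      some (bif b then (u, swapAt i v, swapAt i w) else (swapAt i u, v, swapAt i w))
    else none

/-- Some position before `n` is an ascent of all three words. -/
def commonAscent (u v w : List ℕ) (n : ℕ) : Bool :=
  n.rec false fun i found => (ascends i u && (ascends i v && ascends i w)) || found

/-- The triple has a common ascent, or is `(id, id, w₀)`. -/
def isSolved (n : ℕ) : WordTriple → Bool
  | (u, v, w) =>
    commonAscent u v w n ||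
      (u == List.range n && (v == List.range n && w == (List.range n).reverse))

/-- Perform the descent-cycling moves given by the base-8 digits of `c` until a solved triple is
reached, and return the unused part of `c`. The number of steps is bounded by `k`. -/
def solve (n k : ℕ) : ℕ → WordTriple → Option ℕ :=
  k.rec (fun _ _ => none) fun _ next c t =>
    bif isSolved n t then some c
    else (cycleAt (Nat.div (Nat.mod c 8) 2) (Nat.beq (Nat.mod c 2) 1) t).bind (next (Nat.div c 8))

/-- Solve a list of triples one after the other with the moves encoded in `c`. -/
def solveAll (n : ℕ) (l : List WordTriple) : ℕ → Bool :=
  l.rec (fun _ => true) fun t _ next c => (solve n 15 c t).elim false next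

/-- The words of the permutations of length `k`. -/
def wordsOfLength (n k : ℕ) : List (List ℕ) :=
  (List.range n).permutations'.filter (inversions · == k)

/-- The Schubert problems whose lengths increase weakly. -/
def sortedProblems (n : ℕ) : List WordTriple :=
  (List.range (n.choose 2 + 1)).flatMap fun a =>
    (List.range (n.choose 2 + 1)).flatMap fun b =>
      if a ≤ b ∧ b ≤ n.choose 2 - a - b then
        (wordsOfLength n a).flatMap fun u =>
          (wordsOfLength n b).flatMap fun v =>
            (wordsOfLength n (n.choose 2 - a - b)).map fun w => (u, v, w)
      else []

/-- Descent-cycling moves solving `(id, w₀, id)` and all sorted Schubert problems in turn. -/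
def moves (n : ℕ) : ℕ :=
  Nat.ofDigits (10 ^ 88) <| match n with
  | 2 => [1]
  | 3 => [3657808770289185369]
  | 4 => [7393064935618829008694343208268296964397185827021800145188423431798311691947559465825113,
    2458371614905550445012891412822717217630165576926847963896914759654436894982504535679075,
    3011157474969196974654793324643577478091918225502520995525715268550120393011293059997085,
    8852748499111921338285663989834730262518423520823014108343357125743278179083846157922068,
    2617702675616319310560944]
  | 5 => [3429892612309408450739923108816409333595040363111297829955572333415611660240009305628505,
    9554508527528846055734309376264795459454189966236831225821484551101990679089612992401883,
    8557674712221806860214040999981803060615044666767969117108362215318974857543301060913210,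
    9346299500958720975228508037591269763487680912124093857744364376074610771110342251073614,
    2886160594168659807932806441808468779205137277272001037156026419503854738589333686249886,
    7842222228010826938358232775697086085288350320405564475508833163953480169065136945519527,
    7194287454268205229819011774143748182752637473793001397075463033229551933230009150043986,
    3474887916098341635236605190962963588272318255717026760967262557304742181576439450303544,
    5467910446603390251320105420795518662571172333126337401995867114662346838672852542031219,
    6200470722230979306182859832496118374386060649238859415611225533325535414872376816100740,
    8174056232935613499733003861375447080906979330988135104039403749115897118496491565984658,
    9981192593942284585300963938002680913385991868536322537382308152010475053668775851910112,
    7812522658427920439528779834657582674615333783112510296246421813277675077376089329934864,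
    433597691339822474801810202137464989523111917031927271637317790464258476011357564687529,
    3193496793688548865281724888586671547449421515227726417443747950116399169508243122581564,
    751410726082054166632596329687474236199493956964251967223207220243785327279888384206648,
    7762702773666390899888088486131135019321591285644204444899770951963220286503760526874230,
    4625324432812742033460647743631639026465102693324746887687861194205895600823679608904453,
    5043472268683871558803752635568498461241644768814652284810234525072170452266934686058916,
    1740470246996726125829499430658982633120968888031821491578395870754299934238486597345579,
    9432264147539127195196667742634209426672548145494761608083216337592287701891941733159391,
    582639705903351212738078681311491297780427627890745014804583867215789670107658403774336,
    3323895115746662230742701212052077486560265172796363076171361688289535259010023557235422,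
    6019013183530971752351652452445400758753049688207769882484406594537262647523457265668049,
    2130050976825013632226812287166370504811425486987278822898827478233255750494140034619718,
    6282774675801653190508083509681097551464895792117793961514553963956958658195028901981706,
    9787955472815954992948178629113191565902562404906205044708543673515756362011662770454220,
    7501481081544861426161450207055703006127428919699393105164121086811104481248344175503280,
    8652580694248273514347577967425776089916844255609116074303832691839427266695094970503233,
    5969874274617486514747427521904390172032792635143585230900984554799131659333199149400002,
    6607822238381293254110295304668036262948961239698760867638940973306504971378313978857810,
    6887478249263864489576443250624075702898980365905995234763900775606373412370819500797913,
    6623510842822660694537685687156412189710751854516965208224371245051086374843664624745591,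
    5443339790996476360321757680118168728877084115514280984959490349318684076499982033719615,
    8024304504599656993043310432784200931444168206846917663128753614574538874542303938453685,
    9136365908737798713898730676968321549508099703857891297318993287275213189646824599469813,
    1572873737329027293024858973871607046086607672871737663315999660836181000635544481821185,
    1047794158938252007599605094377930764129363008156755251818051153483678402668071981139734,
    4371355229807825017884700339831835003335661358385783892173343816661986016576757235747361,
    9860078471943321761044710352927670601872835995349915750550081595644783013035259812859933,
    8359974497532069617863753780114775777126297788114796002777258252998511337364479487797077,
    1273116164061792714399348927897653176295592656795739133548978006773012610483033732285035,
    1480846970394061034245898278646642613873724750330036293244243615405705280624993951018048,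
    706108209072115361971986401454793878598778068059967987139759587247099888014062287157524,
    8093281603472346891283463131082290093160017805095592958000367486927190573115951081949357,
    8014214251120754164865460339271560007820064009621034625214288151376532885293045551030989,
    8188613396519550737601181959176444169840618829322937833240176853922563837601506510754614,
    9623606340746390100211169277289299863818630941292524077418207433767773077513406974670795,
    7371769965474284085597862457327313023513500695975501136011776081973012124466695937421110,
    8989261215734131522472212548527883670920473623564499921486574545991710608185221836665908,
    5068119918752303636237693136249193139359796410235087901731514497337526758115055612169975,
    8023328620316806066173909657648138111289343057621881018751295870795863056418517133164883,
    6724162900260107847939177386620568316189396025308921064222159227234493837277675484977123,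
    4135704300272069356383157820665452692237649692018570961556246442258136962412985764285276,
    773733199973811402075827306910638938387403472810511330003777923245392630575150717168397,
    5750323652965242098863790728967987032115895359875506612649143042264431532661552670151700,
    3427284959275349518509871781764590904284177574914875511901301891600902542444445988508371,
    8675484231644921679412597098009491283072278697452742406238023477718550280978031882430868,
    708802713207303025789229128490832235448731898329553331703446801314939162008345554200832,
    2684033776290692064038559409823543376525553305535738193794611268875769296787324481675812,
    9524992248836487672780884192462295538415294251056732176564277767980606585126135772315895,
    5840760484776263015160123121487258084131705508960063405416610479281883655913135896190207,
    5407373078941385371246025932538342243743081008284121235833465079306660774724764484543808,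
    4336469526189969771807221372715322217119692112562673099921441273929429233179607054625250,
    9739707381048889934826825623698519967369359312159023805134758837343517950179930609041200,
    6029024017541967174709879248942866047788896709515835505372159870819506787901928851356576,
    9111532585039320561516006066204981765709811593932195443288988877007126961004038301315314,
    8414129720885900848905133294047065508593102823593939367294198052059225644740977502233634,
    2852081669375040612929389568131865596877345032705025313555303569776990193084025560728870,
    1484984082810477271671289150285877808761586817462969393100208856232842062132213577328196,
    1210564975804671706162645216541371453230741349810906635533274554578339993682694004839493,
    8073951392297698154075198341125225624637009829701511860063697953922143379550529181723540,
    3879630072572957451372562043119290920956570885173114053407173987316345937697499146968781,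
    6985615917560077002953224986878659866837485608643592500726708823606684911874136988284800,
    1250743384829612037743076611828273122055223993443612104809568998688954955818816196968999,
    2358269511441331882806648135789184082585214441065466407199620171070419952899207358306563,
    1294721650795238891499771906913588702437489689713586905099670464428556303307315966201816,
    5315238782293375154125792065129477219155676813584574209069162989948746740753554417266282,
    2148324155197690328357010127175477038042191694862030741181454551570144095649353566740160,
    5453784732337192290296528473968309873707928637633204231969807213162293582374432929732176,
    1019251680922031402578597649661110602679458627504284817919585129578698210421312667147060,
    7605101173785397142325829264829086799599483615815033513602672521677999969390368210982829,
    3223808238299659771005849275102632366274658063083330981014021452901366985092663416067663,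
    433191044433511760273555146347325676343000018869685779850400516610940250692878010095052,
    4175465296298621356019598191116340038588972946575797500723043026977256009017358686148720,
    7245365307849641881057500783070906470197653379981002510145437941507211487130140972524247,
    1352375659876206343622524704581369508114395726174292338220073793705870363925870826787228,
    7132157564249484249438800252955872513608289332424792526527885484095572710922440399279740,
    2730394876315868105999651464348992804348945173240370175834522147894717165675772911039742,
    3210719490830977405986459648267879750072707060682697394517109691752383384671633796095877,
    2349400105744904196994388012422627489274057918610581608764467766875178653858257200864490,
    4467496676286174233326886741461040542436563042707352594185877865458606146268798584128541,
    3296079270052112925254563008301158652092371161127626745177911592360040459755961582933140,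
    3131638635201797799469184948895410096068871155601573202218591602511278803347622465713491,
    6852282121465882801425387618991451833900629498437384817055037062452810885970492240721338,
    2872897577509989477058590843049600864644556582838268943676450930381128578636554710249515,
    8366298030564555909604292930731617352878265015099789371675112083092586375408325093637770,
    7383512140460806478546851184314818569832064734439842343775333049025650852000331513645460,
    2360007986382955800405646567133997956952498853555271795385480810949868263476419556169693,
    8681163061721783748930636774725619368704276998026805717446577214264004494330060172848750,
    6866951744302003987716106156598211926663725044189769536615131048316089142832853031932403,
    7343098239641750780576322485862609621542192593532363911610113293442348856272776588999639,
    89021773600516269376584960812243092215995515806737518858967472066847822639467418327890,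
    882661837710014720206505207467528013778525760212920390433362147765634211596851991453813,
    3556286977965597573973006592835362873118736357417680494538525391170100022875973549801447,
    375171956797458914231584687642636673548079804603945486536428996232777403885136866935852,
    1892950777000740248574733521321549789516304363060672095846008055351866923157207845086526,
    5027911325063376288915175309324819871258646465725829614262260735972810103522073282706239,
    2855328020688085681259154155786116818252383178676302685584095840672208446532250698567273,
    305276755495456230470733050018362134782410445753488660698147775264468850603537546419698,
    4649445548943863065850990398841198262028761224126153506023898540527689930154944207504294,
    4719262929405089428239098764827792225619216324572413804957456301457673536211436626939061,
    1350633528831472150071929160257615387889271857534168627010124785502352905242080935257940,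
    6794572520643528294827998591949888329364413255702804072940950553801426968406005764878297,
    2577174788081621176895914338656583550863906653604131888725320778338758321611246573742488,
    4466221657612887593774530148954095125361727166417815968752696739482289508685739894299579,
    3623531939170053725142960043820789860625080610973203045574594626350835184816436538986275,
    2222917251845576043090499418557510205453998833588347793655086360962043357612237587254636,
    4288256762431332308906224798118393283798709533919398419035505661558955478224934048459271,
    3961278026943349758158960343779832884794065933179591645557308928419657579835508165115515,
    491825107010273513065420768074775827261087897123762777646920311786181558121648145474050,
    3215418744583724393799523901695832718939316171905420074023542799249763886050548557875069,
    2784130504923832685883433563641082847327791610246133579605552601974817947177577250650129,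
    7246454449716852019931305158116601927310472580043548190822090061035308986775080605051336,
    8017549310364588511452266952111953948234315909951215469598528706148488971429199193906504,
    8053701637280964508692678227843705981598684856893518148537054266204498742996048578371153,
    757464034642476106649600606062637846659063598434364318810550837982494590786576573904163,
    6377597453185732451600882072587588945258972693021969156596222414022226404890580312793076,
    5151325861480987677277228969713892955442486582721948961119113759990262158749422479081679,
    4343614486642588918445686590669169956528543243160032880230185496322784342138019504651993,
    6390785790945548716407830273965144235305943999185220368658696018617993031070517310845419,
    3434256217350563211768868854307038098993346159151078994510413201824145828625640477631148,
    5147578939489531778647962190279773263289459090566550268998231283493924230437854130709975,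
    8198870084784927775952023703980429132287770121272447388686406309731059963397484619283077,
    4275269538891807423737486673685261623434454524410374604105950221675502032094182258050054,
    5832609958832390736558134572772136182094094940583396401725319213544336265021746210354876,
    8548934081003271220687423943804461795092701203417072416596045920417802023572723840748761,
    6332003729420528971305904354049127219471085623173926533011662862558952681259303742442039,
    1987446429057086412786102819831575407904650804241688758513306294716809010227122976287692,
    9130434327969559112195774958050405077809641808744447728676950662920163146929806335710625,
    8448424680172809339299264830872548338960435657030161386039099544536876891942638492105202,
    1201019475948700566596898729676150949250623266446997456828305175296582336249917760429475,
    1925077603447767010461182647720613714357215208184255707858065573398685615136509282606635,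
    2057077581503802771678900044076000565505930153121813738136958038613512277818978314450480,
    1265935587454428432498507408636272615078583771813246490141760086055578255743727338779958,
    4114980988097357342980876733203733886480352367118088388328538990141352426568252364481262,
    8325239001238967161574366055643137122440948737046881012840811800463464354973413830880509,
    2038481638666269139417618287093405928063992265211163589331971802982714244406953681192077,
    8835637242906923346758026545434527402201692513748419747478100950190252935878157658144852,
    9320727272830540934804153068371410301061106335050321813927374050664830142725487300120881,
    3994553315738041542469782498292803869921749764091295352470689724303322613130829885234059,
    3073157101213762546959610909662944255887527674578846267174953502141526766032932629305322,
    3178565447699674547248039289162006284181009223001587512027772899579491196702672330344636,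
    6100272649223299200916082106913054067378409926839777839310339886844345469237361395160265,
    5885532270779222455056764393120881935709434914393424348593154960032879264301172129184361,
    7480911849690930744326749094967263113662682754899763281828818729670306919226242060530604,
    6029714481444756135144092845839109881027587069474049897638879946758137014168022794025592,
    5139798244936125066596363425262990446851979495768500546820488744286876218048698854136651,
    748704184829825596185214106417760595291343592625552574862901519808004331559152560132619,
    3725413837512747706048146769390483537153956850594004255727339115817256636987771031006458,
    6979861040870063904150834425266561909430774124470950019797076602017957403067669595577604,
    8055309938706161052646745127635297593954531975862122842569227203810675230589388458754250,
    2904463110559899095809930767413378067548828919605254782888126887985360519525146200644400,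
    5471183594203256452804659459713164125000356877004492605006433720903703666082268998845551,
    6893949153319245170239077079616682159505756168323758025661667075600749145175510896678170,
    1620089233141646757424168604923929272274392319950893499439725243516029298492886431612179,
    2531630373774592683990822229057132448062743243614216340419728373400521942436489895832460,
    7281923794174502837855021454216524414837155395423781253178334018250815805373927246944692,
    5695996783866088943216500896367554149624566627828860001853314852924657494886934522160849,
    6262176035723454754271641146191364052031581848611966403324801375969007783584589678505402,
    3668967614126218687133341508261598546795426025846943814412847853764438527623870512224164,
    7082795740038460327581105797859670382679084173202072473820886940881915225937903961608338,
    9600545101213342249479369493147231543983633709547183946395833761185391912148932406919785,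
    3424195610150866213012456111236665507841322822240064002719658496655978236618426742704757,
    3085775498880448121830690840269756425787956910490631570224881550702135680406538605490390,
    9991135372192013316163437430627425753562008441113690395954063195540431966486708857473478,
    5668796314614930875569670477260467094223435411974205209083732742551732644632383785297727,
    9474460179905850872281305367934950428528712096028363460781914479223421631336699923996441,
    8001216662521012478464726962402051287237862600609798109957643127540865564275805833585995,
    4640892065767144621653086315373042235694674758580065995832662374130697434097601340293828,
    8700707206814904776192262232097341878833125893061005562473697900101531260338738237176708,
    3294540843833647692372169005038992520839844560381130080129559693618485149152704660466879,
    3123641641987995540149049187085077787322722525401887834938025504760816080381678256985908,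
    5188947707097580192220559607288088949041572386357455307385630465891357240370994643718870,
    1772005337342024001274275141406736635082653088948121090066294555719232185275621069165270,
    2355215658344527885990833795209390205795897534079567710390442785034778736903853580205288,
    5105046101587298668718122526298834406317625581311401553539278507568244436433518462993884,
    5200002283413958690924246918058844933667873210368707715744192588365292674733165551406459,
    1402792849686165204961808462514107659754552328607338280209348567327440682375982060583989,
    8970255036219247678263358345308894635386172907885251226555127553877852646159456360152703,
    762789572620326646596997634377016909089388983444334725441939216894476332998918787301963,
    7509774414763171181174615512994824586560496084572984668085444914410820348385090082084806,
    2958107127726150139827268008363025841620619694261549332418075913377353916243693387743822,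
    6460676673698267490486686543355679372438025751858519897607241340306176839718288558237358,
    4825154987614538000119698300801640669625615451106528141524997486904271403429002107789047,
    7885463338033346811679636215447104080700429145890894098974413660337966721863493205053302,
    556486067174355389443545913319569581467432593079356163447650683810867519223278173219616,
    2830679720993379409944008983784881587140505081324449983187478652741676711488990428622448,
    4862326462412903021105286271227414438550401133613711831879520644857265130299408472973677,
    6453826734878462063250039697752639223902263577685004248484822895949540783553453956508739,
    4374087231215256655428581037263118918238370522486613607813106045845531735070729956105339,
    6332421877498529677406442713048200666034777595785546934125474387039661467696760021545864,
    6463003286318120581535057100130296992742356839324189199203134384366181692067188852898379,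
    8504792108681229243985910228742015789482816989072041874723480006630683657334468154965011,
    9755914255205056549143268806412595460396902781481746492194430486397855727771575157762910,
    449284912856889402548481741144678686372598382977]
  | _ => []

/-- The one-line notation of a permutation, as a word. -/
def word {n : ℕ} (π : Equiv.Perm (Fin n)) : List ℕ := List.ofFn fun j => (π j : ℕ)

@[simp]
theorem length_word {n : ℕ} (π : Equiv.Perm (Fin n)) : (word π).length = n := by simp [word]

@[simp]
theorem getElem_word {n : ℕ} (π : Equiv.Perm (Fin n)) (j : ℕ) (h : j < (word π).length) :
    (word π)[j] = π ⟨j, by simpa using h⟩ := by simp [word]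

theorem word_injective {n : ℕ} : Function.Injective (word (n := n)) := fun π σ h => by
  ext j
  exact congrFun (List.ofFn_injective h) j

theorem word_one (n : ℕ) : word (1 : Equiv.Perm (Fin n)) = List.range n :=
  List.ext_getElem (by simp) (by simp)

theorem word_w0 (n : ℕ) : word (w0 n) = (List.range n).reverse :=
  List.ext_getElem (by simp) fun i hi _ => by simp [w0, Fin.val_rev]; omega

theorem word_perm_range {n : ℕ} (π : Equiv.Perm (Fin n)) : (word π).Perm (List.range n) := by
  rw [← word_one]
  exact Equiv.Perm.ofFn_comp_perm π (fun j => (j : ℕ))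

theorem inversions_ofFn {n : ℕ} (f : Fin n → ℕ) :
    inversions (List.ofFn f) =
      (Finset.univ.filter fun p : Fin n × Fin n => p.1 < p.2 ∧ f p.2 < f p.1).card := by
  induction n with
  | zero => simp [inversions]
  | succ n ih =>
    have hcount : ∀ (m : ℕ) (g : Fin m → ℕ) (a : ℕ),
        (List.ofFn g).countP (· < a) = ∑ j, if g j < a then 1 else 0 := by
      intro m g a
      induction m with
      | zero => simp
      | succ m ihm =>
        rw [List.ofFn_succ, List.countP_cons, ihm, Fin.sum_univ_succ, add_comm]
        simp only [decide_eq_true_eq]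
    rw [List.ofFn_succ, inversions, ih, hcount]
    simp only [Finset.card_filter, Fintype.sum_prod_type, Fin.sum_univ_succ]
    simp

theorem inversions_word {n : ℕ} (π : Equiv.Perm (Fin n)) : inversions (word π) = len π := by
  simp [word, inversions_ofFn, len]

theorem word_mem_wordsOfLength {n : ℕ} (π : Equiv.Perm (Fin n)) :
    word π ∈ wordsOfLength n (len π) := by
  simp [wordsOfLength, word_perm_range, inversions_word]

theorem compareAt_eq_true {r : ℕ → ℕ → Bool} {i : ℕ} {l : List ℕ} :
    compareAt r i l = true ↔ ∃ h : i + 1 < l.length, r l[i] l[i + 1] = true := by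
  induction i generalizing l with
  | zero => rcases l with _ | ⟨a, _ | ⟨b, l⟩⟩ <;> simp [compareAt]
  | succ i ih =>
    rcases l with _ | ⟨a, l⟩
    · simp [compareAt]
    · change compareAt r i l = true ↔ _
      simp [ih]

theorem ascends_word {n : ℕ} {π : Equiv.Perm (Fin n)} {i : ℕ} :
    ascends i (word π) = true ↔ Ascent π i := by
  simp [ascends, compareAt_eq_true, Ascent]

theorem descends_word {n : ℕ} {π : Equiv.Perm (Fin n)} {i : ℕ} :
    descends i (word π) = true ↔ Descent π i := by
  simp [descends, compareAt_eq_true, Descent]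

theorem swapAt_perm (i : ℕ) (l : List ℕ) : (swapAt i l).Perm l := by
  induction i generalizing l with
  | zero =>
    rcases l with _ | ⟨a, _ | ⟨b, l⟩⟩
    · exact .refl _
    · exact .refl _
    · exact .swap a b l
  | succ i ih =>
    rcases l with _ | ⟨a, l⟩
    · exact .refl _
    · exact (ih l).cons a

theorem getElem?_swapAt {i : ℕ} {l : List ℕ} (h : i + 1 < l.length) (j : ℕ) :
    (swapAt i l)[j]? = l[Equiv.swap i (i + 1) j]? := by
  induction i generalizing l j with
  | zero =>
    rcases l with _ | ⟨a, _ | ⟨b, l⟩⟩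
    · simp at h
    · simp at h
    · change (b :: a :: l)[j]? = _
      rcases j with _ | _ | j <;> simp [Equiv.swap_apply_def]
  | succ i ih =>
    rcases l with _ | ⟨a, l⟩
    · simp at h
    · change (a :: swapAt i l)[j]? = _
      rcases j with _ | j
      · simp [Equiv.swap_apply_def]
      · rw [List.getElem?_cons_succ, ih (by simpa using h)]
        simp only [Equiv.swap_apply_def, Nat.add_right_cancel_iff]
        split_ifs <;> simp

theorem word_mul_s {n i : ℕ} (h : i + 1 < n) (π : Equiv.Perm (Fin n)) :
    word (π * s n i) = swapAt i (word π) := by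
  refine List.ext_getElem? fun j => ?_
  rw [getElem?_swapAt (by simpa using h)]
  simp only [word, List.getElem?_ofFn, s, h, Equiv.swap_apply_def, dite_true]
  by_cases hi : j = i
  · subst hi
    simp [h, Nat.lt_of_succ_lt h]
  by_cases hi' : j = i + 1
  · subst hi'
    simp [h, Nat.lt_of_succ_lt h]
  · simp [hi, hi', Equiv.swap_apply_of_ne_of_ne]

theorem inversions_swapAt {i : ℕ} {l : List ℕ} (h : descends i l = true) :
    inversions (swapAt i l) + 1 = inversions l := by
  induction i generalizing l with
  | zero =>
    rcases l with _ | ⟨a, _ | ⟨b, l⟩⟩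
    · simp [descends, compareAt] at h
    · simp [descends, compareAt] at h
    · have h : b < a := by simpa [descends, compareAt] using h
      change inversions (b :: a :: l) + 1 = _
      simp only [inversions, List.countP_cons, h, h.asymm, decide_true, decide_false]
      grind
  | succ i ih =>
    rcases l with _ | ⟨a, l⟩
    · simp [descends, compareAt] at h
    · change inversions (a :: swapAt i l) + 1 = _
      simp only [inversions, (swapAt_perm i l).countP_eq]
      have := ih (l := l) h
      omega

theorem Descent.len_mul_s {n i : ℕ} {π : Equiv.Perm (Fin n)} (h : Descent π i) :
    len (π * s n i) + 1 = len π := by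
  rw [← inversions_word, ← inversions_word, word_mul_s h.1, inversions_swapAt (descends_word.2 h)]

@[simp]
theorem mul_s_mul_s {n : ℕ} (π : Equiv.Perm (Fin n)) (i : ℕ) : π * s n i * s n i = π := by
  unfold s
  split_ifs <;> simp [mul_assoc]

theorem Descent.ascent_mul_s {n i : ℕ} {π : Equiv.Perm (Fin n)} (h : Descent π i) :
    Ascent (π * s n i) i := by
  obtain ⟨hi, h⟩ := h
  exact ⟨hi, by simpa [s, hi] using h⟩

theorem Ascent.descent_mul_s {n i : ℕ} {π : Equiv.Perm (Fin n)} (h : Ascent π i) :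
    Descent (π * s n i) i := by
  obtain ⟨hi, h⟩ := h
  exact ⟨hi, by simpa [s, hi] using h⟩

theorem Ascent.len_mul_s {n i : ℕ} {π : Equiv.Perm (Fin n)} (h : Ascent π i) :
    len (π * s n i) = len π + 1 := by
  simpa using h.descent_mul_s.len_mul_s.symm

/-! ### Solvable Schubert problems -/

/-- The triple is dc-equivalent to a dc-trivial Schubert problem or to `(id, id, w₀)`. -/
def Solvable {n : ℕ} (P : Triple n) : Prop :=
  (∃ Q : Triple n, DCTrivial Q ∧ DCEquiv P Q) ∨ DCEquiv P (1, 1, w0 n)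

theorem Solvable.of_dcEquiv {n : ℕ} {P P' : Triple n} (h : DCEquiv P P') (h' : Solvable P') :
    Solvable P := by
  rcases h' with ⟨Q, hQ, hPQ⟩ | h'
  · exact .inl ⟨Q, hQ, h.trans hPQ⟩
  · exact .inr (h.trans h')

theorem DCEquiv.map {n : ℕ} {f : Triple n → Triple n}
    (hf : ∀ P P', DCMove P P' → DCMove (f P) (f P')) {P P' : Triple n} (h : DCEquiv P P') :
    DCEquiv (f P) (f P') :=
  Relation.ReflTransGen.lift f hf _ _ h

/-- Exchange the first two permutations of a triple. -/
def swapFirst {n : ℕ} (P : Triple n) : Triple n := (P.2.1, P.1, P.2.2)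

/-- Exchange the last two permutations of a triple. -/
def swapLast {n : ℕ} (P : Triple n) : Triple n := (P.1, P.2.2, P.2.1)

theorem DCMove.swapFirst {n : ℕ} {P P' : Triple n} (h : DCMove P P') :
    DCMove (swapFirst P) (swapFirst P') := by
  obtain ⟨u, v, w, i, hl, hu, hv, hw, h, h'⟩ := h
  refine ⟨v, u, w, i, by omega, hv, hu, hw, ?_, ?_⟩
  · rcases h with rfl | rfl | rfl <;> simp [MoveSet, DC.swapFirst]
  · rcases h' with rfl | rfl | rfl <;> simp [MoveSet, DC.swapFirst]

theorem DCMove.swapLast {n : ℕ} {P P' : Triple n} (h : DCMove P P') :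
    DCMove (swapLast P) (swapLast P') := by
  obtain ⟨u, v, w, i, hl, hu, hv, hw, h, h'⟩ := h
  refine ⟨u, w, v, i, by omega, hu, hw, hv, ?_, ?_⟩
  · rcases h with rfl | rfl | rfl <;> simp [MoveSet, DC.swapLast]
  · rcases h' with rfl | rfl | rfl <;> simp [MoveSet, DC.swapLast]

theorem Solvable.swapFirst {n : ℕ} {P : Triple n} (h : Solvable P) : Solvable (swapFirst P) := by
  rcases h with ⟨Q, ⟨hQ, i, hu, hv, hw⟩, hPQ⟩ | h
  · refine .inl ⟨DC.swapFirst Q, ⟨?_, i, hv, hu, hw⟩, hPQ.map fun _ _ => DCMove.swapFirst⟩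
    simp only [IsSchubert, DC.swapFirst] at hQ ⊢
    omega
  · exact .inr (h.map fun _ _ => DCMove.swapFirst)

theorem Solvable.swapLast {n : ℕ} {P : Triple n} (h : Solvable P)
    (h₀ : Solvable ((1, w0 n, 1) : Triple n)) : Solvable (swapLast P) := by
  rcases h with ⟨Q, ⟨hQ, i, hu, hv, hw⟩, hPQ⟩ | h
  · refine .inl ⟨DC.swapLast Q, ⟨?_, i, hu, hw, hv⟩, hPQ.map fun _ _ => DCMove.swapLast⟩
    simp only [IsSchubert, DC.swapLast] at hQ ⊢
    omega
  · exact .of_dcEquiv (h.map fun _ _ => DCMove.swapLast) h₀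

/-- The words of the three permutations of a triple. -/
def words {n : ℕ} (P : Triple n) : WordTriple := (word P.1, word P.2.1, word P.2.2)

theorem exists_ascents_of_commonAscent {u v w : List ℕ} {n : ℕ}
    (h : commonAscent u v w n = true) :
    ∃ i, ascends i u = true ∧ ascends i v = true ∧ ascends i w = true := by
  induction n with
  | zero => simp [commonAscent] at h
  | succ n ih =>
    change (_ || commonAscent u v w n) = true at h
    simp only [Bool.or_eq_true, Bool.and_eq_true] at h
    exact h.elim (fun h => ⟨n, h⟩) ih

theorem solvable_of_isSolved {n : ℕ} {P : Triple n} (hP : IsSchubert P)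
    (h : isSolved n (words P) = true) : Solvable P := by
  simp only [isSolved, words, Bool.or_eq_true, Bool.and_eq_true, beq_iff_eq] at h
  rcases h with h | ⟨hu, hv, hw⟩
  · obtain ⟨i, hi⟩ := exists_ascents_of_commonAscent h
    simp only [ascends_word] at hi
    exact .inl ⟨P, ⟨hP, i, hi⟩, .refl⟩
  · rw [← word_one] at hu hv
    rw [← word_w0] at hw
    have : P = (1, 1, w0 n) :=
      Prod.ext (word_injective hu) (Prod.ext (word_injective hv) (word_injective hw))
    exact .inr (this ▸ .refl)

theorem isSchubert_of_mem_moveSet {n i : ℕ} {u v w : Equiv.Perm (Fin n)} {P : Triple n}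
    (hl : len u + len v + len w + 1 = n.choose 2) (hu : Ascent u i) (hv : Ascent v i)
    (hw : Ascent w i) (hP : P ∈ MoveSet u v w i) : IsSchubert P := by
  rcases hP with rfl | rfl | rfl <;>
    simp only [IsSchubert, hu.len_mul_s, hv.len_mul_s, hw.len_mul_s] <;> omega

theorem exists_dcMove_of_cycleAt {n i : ℕ} {b : Bool} {P : Triple n} {t : WordTriple}
    (hP : IsSchubert P) (h : cycleAt i b (words P) = some t) :
    ∃ P', IsSchubert P' ∧ DCMove P P' ∧ words P' = t := by
  have key : ∀ {u v w : Equiv.Perm (Fin n)} {P' : Triple n},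
      len u + len v + len w + 1 = n.choose 2 → Ascent u i → Ascent v i → Ascent w i →
      P ∈ MoveSet u v w i → P' ∈ MoveSet u v w i → words P' = t →
      ∃ P', IsSchubert P' ∧ DCMove P P' ∧ words P' = t :=
    fun hl hu hv hw hP hP' ht =>
      ⟨_, isSchubert_of_mem_moveSet hl hu hv hw hP', ⟨_, _, _, i, hl, hu, hv, hw, hP, hP'⟩, ht⟩
  obtain ⟨u, v, w⟩ := P
  simp only [IsSchubert] at hP
  simp only [cycleAt, words, cond_eq_ite] at h
  split_ifs at h with h₁ hb h₂ hb h₃ hb <;> rw [Option.some_inj] at h <;> subst h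
  · simp only [Bool.and_eq_true, ascends_word, descends_word] at h₁
    have hl := h₁.1.len_mul_s
    exact key (P' := (u * s n i, v, w * s n i)) (by omega) h₁.1.ascent_mul_s h₁.2.1 h₁.2.2
      (by simp [MoveSet]) (by simp [MoveSet]) (by simp [words, word_mul_s h₁.1.1])
  · simp only [Bool.and_eq_true, ascends_word, descends_word] at h₁
    have hl := h₁.1.len_mul_s
    exact key (P' := (u * s n i, v * s n i, w)) (by omega) h₁.1.ascent_mul_s h₁.2.1 h₁.2.2
      (by simp [MoveSet]) (by simp [MoveSet]) (by simp [words, word_mul_s h₁.1.1])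
  · simp only [Bool.and_eq_true, ascends_word, descends_word] at h₂
    have hl := h₂.2.1.len_mul_s
    exact key (P' := (u, v * s n i, w * s n i)) (by omega) h₂.1 h₂.2.1.ascent_mul_s h₂.2.2
      (by simp [MoveSet]) (by simp [MoveSet]) (by simp [words, word_mul_s h₂.1.1])
  · simp only [Bool.and_eq_true, ascends_word, descends_word] at h₂
    have hl := h₂.2.1.len_mul_s
    exact key (P' := (u * s n i, v * s n i, w)) (by omega) h₂.1 h₂.2.1.ascent_mul_s h₂.2.2
      (by simp [MoveSet]) (by simp [MoveSet]) (by simp [words, word_mul_s h₂.1.1])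
  · simp only [Bool.and_eq_true, ascends_word, descends_word] at h₃
    have hl := h₃.2.2.len_mul_s
    exact key (P' := (u, v * s n i, w * s n i)) (by omega) h₃.1 h₃.2.1 h₃.2.2.ascent_mul_s
      (by simp [MoveSet]) (by simp [MoveSet]) (by simp [words, word_mul_s h₃.1.1])
  · simp only [Bool.and_eq_true, ascends_word, descends_word] at h₃
    have hl := h₃.2.2.len_mul_s
    exact key (P' := (u * s n i, v, w * s n i)) (by omega) h₃.1 h₃.2.1 h₃.2.2.ascent_mul_s
      (by simp [MoveSet]) (by simp [MoveSet]) (by simp [words, word_mul_s h₃.1.1])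

theorem solvable_of_solve {n k c c' : ℕ} {P : Triple n} (hP : IsSchubert P)
    (h : solve n k c (words P) = some c') : Solvable P := by
  induction k generalizing c P with
  | zero => simp [solve] at h
  | succ k ih =>
    change (bif isSolved n (words P) then some c
      else (cycleAt _ _ (words P)).bind (solve n k (Nat.div c 8))) = some c' at h
    rcases hs : isSolved n (words P) with _ | _
    · rw [hs, cond_false, Option.bind_eq_some_iff] at h
      obtain ⟨t, ht, h⟩ := h
      obtain ⟨P', hP', hm, rfl⟩ := exists_dcMove_of_cycleAt hP ht
      exact .of_dcEquiv (.single hm) (ih hP' h)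
    · exact solvable_of_isSolved hP hs

theorem exists_solve_of_solveAll {n c : ℕ} {l : List WordTriple} (h : solveAll n l c = true)
    {t : WordTriple} (ht : t ∈ l) : ∃ k c c', solve n k c t = some c' := by
  induction l generalizing c with
  | nil => simp at ht
  | cons t' l ih =>
    change (solve n 15 c t').elim false (solveAll n l) = true at h
    rcases hs : solve n 15 c t' with _ | c'
    · simp [hs] at h
    · rw [hs] at h
      rcases List.mem_cons.1 ht with rfl | ht
      · exact ⟨15, c, c', hs⟩
      · exact ih h ht

theorem words_mem_sortedProblems {n : ℕ} {P : Triple n} (hP : IsSchubert P)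
    (h : len P.1 ≤ len P.2.1) (h' : len P.2.1 ≤ len P.2.2) : words P ∈ sortedProblems n := by
  simp only [IsSchubert] at hP
  have hw : n.choose 2 - len P.1 - len P.2.1 = len P.2.2 := by omega
  simp only [sortedProblems, List.mem_flatMap, List.mem_range]
  refine ⟨len P.1, by omega, len P.2.1, by omega, ?_⟩
  rw [hw, if_pos ⟨h, h'⟩]
  simp only [List.mem_flatMap, List.mem_map]
  exact ⟨_, word_mem_wordsOfLength _, _, word_mem_wordsOfLength _, _, word_mem_wordsOfLength _, rfl⟩

theorem isSchubert_one_w0_one {n : ℕ} (hn : n ≤ 5) : IsSchubert ((1, w0 n, 1) : Triple n) := by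
  simp only [IsSchubert, ← inversions_word, word_one, word_w0]
  interval_cases n <;> decide

theorem solvable_of_solveAll {n c : ℕ} (hn : n ≤ 5)
    (hc : solveAll n ((List.range n, (List.range n).reverse, List.range n) :: sortedProblems n) c
      = true) {P : Triple n} (hP : IsSchubert P) : Solvable P := by
  have solvable_of_mem : ∀ {P : Triple n}, IsSchubert P →
      words P ∈ (List.range n, (List.range n).reverse, List.range n) :: sortedProblems n →
      Solvable P := fun hP h => by
    obtain ⟨_, _, _, h⟩ := exists_solve_of_solveAll hc h
    exact solvable_of_solve hP h
  have h₀ : Solvable ((1, w0 n, 1) : Triple n) :=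
    solvable_of_mem (isSchubert_one_w0_one hn) (by simp [words, word_one, word_w0])
  have sorted : ∀ {u v w : Equiv.Perm (Fin n)}, len u + len v + len w = n.choose 2 →
      len u ≤ len v → len v ≤ len w → Solvable (u, v, w) := fun hl h h' =>
    solvable_of_mem hl (List.mem_cons_of_mem _ (words_mem_sortedProblems hl h h'))
  obtain ⟨u, v, w⟩ := P
  simp only [IsSchubert] at hP
  rcases le_total (len u) (len v) with huv | huv <;>
    rcases le_total (len v) (len w) with hvw | hvw <;>
    rcases le_total (len u) (len w) with huw | huw
  · exact sorted hP huv hvw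
  · exact sorted hP huv hvw
  · exact (sorted (by omega) huw hvw).swapLast h₀
  · exact ((sorted (by omega) huw huv).swapFirst).swapLast h₀
  · exact (sorted (by omega) huv huw).swapFirst
  · exact ((sorted (by omega) hvw huw).swapLast h₀).swapFirst
  · exact (((sorted (by omega) hvw huv).swapLast h₀).swapFirst).swapLast h₀
  · exact (((sorted (by omega) hvw huv).swapLast h₀).swapFirst).swapLast h₀

theorem solveAll_sortedProblems {n : ℕ} (hn : n ≤ 5) :
    solveAll n ((List.range n, (List.range n).reverse, List.range n) :: sortedProblems n)
      (moves n) = true := by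
  interval_cases n <;> decide +kernel

end DC

/-- For n ≤ 5, every Schubert problem for S_n is either dc-equivalent to a dc-trivial
Schubert problem or dc-equivalent to (id, id, w₀). -/
theorem statement10 {n : ℕ} (hn : n ≤ 5) (P : DC.Triple n) (hP : DC.IsSchubert P) :
    (∃ Q : DC.Triple n, DC.DCTrivial Q ∧ DC.DCEquiv P Q) ∨
      DC.DCEquiv P (1, 1, DC.w0 n) := by
  exact DC.solvable_of_solveAll hn (DC.solveAll_sortedProblems hn) hP
end

section
/- Exactly 2,351,475 of the Schubert problems for S_6 are not dc-trivial; that is, the number of triples (u,v,w) of permutations of {1,…,6} with ℓ(u)+ℓ(v)+ℓ(w)=15 such that for every position i ∈ {1,…,5} at least one of u,v,w has a descent at i, is exactly 2,351,475. -/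
open scoped Classical

/-- The number of inversions of a word. -/
def inversions : List ℕ → ℕ
  | [] => 0
  | a :: l => l.countP (fun b => decide (b < a)) + inversions l

/-- The word `π(0), π(1), …` of a permutation. -/
def word {n : ℕ} (π : Equiv.Perm (Fin n)) : List ℕ := List.ofFn fun i => (π i : ℕ)

/-- Whether a word ascends at position `i`. -/
def wordAscent (i : ℕ) (l : List ℕ) : Bool := decide (l.getD i 0 < l.getD (i + 1) 0)

/-- The sum of `f u * f v * f w` over the triples from `L` no member of `ps` holds on all of,
computed by inclusion-exclusion. -/
def inclExcl {α : Type*} (f : α → ℕ) : List (α → Bool) → List α → ℕ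
  | [], L => (L.map f).sum ^ 3
  | p :: ps, L => inclExcl f ps L - inclExcl f ps (L.filter p)

theorem sum_triples_eq_inclExcl {α : Type*} [DecidableEq α] (f : α → ℕ) (ps : List (α → Bool))
    (L : List α) (hL : L.Nodup) :
    ∑ t ∈ L.toFinset ×ˢ L.toFinset ×ˢ L.toFinset with
      ∀ p ∈ ps, ¬ (p t.1 ∧ p t.2.1 ∧ p t.2.2), f t.1 * (f t.2.1 * f t.2.2) =
      inclExcl f ps L := by
  induction ps generalizing L with
  | nil =>
    simp [inclExcl, Finset.sum_product, ← Finset.mul_sum, ← Finset.sum_mul,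
      List.sum_toFinset f hL, pow_three]
  | cons p ps ih =>
    rw [inclExcl, ← ih L hL, ← ih _ (hL.filter p)]
    refine Nat.eq_sub_of_add_eq (Eq.trans ?_ (Finset.sum_filter_add_sum_filter_not
      (Finset.filter _ (L.toFinset ×ˢ _)) (fun t => ¬ (p t.1 ∧ p t.2.1 ∧ p t.2.2)) _))
    congr 1 <;> refine Finset.sum_congr ?_ fun _ _ => rfl
    · ext t
      simp only [Finset.mem_filter, List.forall_mem_cons]
      tauto
    · ext t
      simp only [Finset.mem_filter, Finset.mem_product, List.mem_toFinset, List.mem_filter]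
      tauto

theorem sum_pow_div_mod {α : Type*} (A : Finset α) (g : α → ℕ) (B k : ℕ) (hA : A.card < B) :
    (∑ x ∈ A, B ^ g x) / B ^ k % B = (A.filter fun x => g x = k).card := by
  have hB : 0 < B := by omega
  have low : ∑ x ∈ A with g x < k, B ^ g x < B ^ k := by
    rcases k with _ | k
    · simp
    · calc ∑ x ∈ A with g x < k + 1, B ^ g x
          ≤ ∑ x ∈ A with g x < k + 1, B ^ k := Finset.sum_le_sum fun x hx =>
            Nat.pow_le_pow_right hB (Nat.lt_succ_iff.mp (Finset.mem_filter.mp hx).2)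
        _ = (A.filter fun x => g x < k + 1).card * B ^ k := by simp
        _ ≤ A.card * B ^ k := Nat.mul_le_mul_right _ (Finset.card_filter_le _ _)
        _ < B ^ (k + 1) := by
          rw [pow_succ']
          exact Nat.mul_lt_mul_of_pos_right hA (by positivity)
  obtain ⟨D, hD⟩ : B ^ (k + 1) ∣ ∑ x ∈ A with k < g x, B ^ g x :=
    Finset.dvd_sum fun x hx => pow_dvd_pow B (Finset.mem_filter.mp hx).2
  have mid : ∑ x ∈ A with g x = k, B ^ g x = B ^ k * (A.filter fun x => g x = k).card := by
    rw [Finset.sum_congr rfl fun x hx => congrArg (B ^ ·) (Finset.mem_filter.mp hx).2]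
    simp [mul_comm]
  have split : ∑ x ∈ A, B ^ g x =
      ∑ x ∈ A with g x < k, B ^ g x + B ^ k * ((A.filter fun x => g x = k).card + B * D) := by
    rw [mul_add, ← mul_assoc, ← pow_succ, ← hD, ← mid]
    simp only [Finset.sum_filter, ← Finset.sum_add_distrib]
    refine Finset.sum_congr rfl fun x _ => ?_
    rcases lt_trichotomy (g x) k with h | h | h
    · simp [h, h.ne, h.not_gt]
    · simp [h]
    · simp [h, h.ne', h.not_gt]
  rw [split, Nat.add_mul_div_left _ _ (by positivity), Nat.div_eq_of_lt low, zero_add,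
    Nat.add_mul_mod_self_left,
    Nat.mod_eq_of_lt ((Finset.card_filter_le _ _).trans_lt hA)]

theorem countP_ofFn {α : Type*} {n : ℕ} (f : Fin n → α) (p : α → Bool) :
    (List.ofFn f).countP p = ∑ i, if p (f i) then 1 else 0 := by
  induction n with
  | zero => simp
  | succ n ih => rw [List.ofFn_succ, List.countP_cons, ih, Fin.sum_univ_succ, add_comm]

theorem inversions_ofFn {n : ℕ} (f : Fin n → ℕ) :
    inversions (List.ofFn f) = ∑ i, ∑ j, if i < j ∧ f j < f i then 1 else 0 := by
  induction n with
  | zero => simp [inversions]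
  | succ n ih =>
    rw [List.ofFn_succ, inversions, ih, countP_ofFn, Fin.sum_univ_succ]
    simp only [Fin.sum_univ_succ, Fin.succ_pos, Fin.succ_lt_succ_iff, Fin.not_lt_zero, lt_irrefl]
    simp

theorem inversions_word {n : ℕ} (π : Equiv.Perm (Fin n)) : inversions (word π) = DC.len π := by
  rw [word, inversions_ofFn, DC.len, Finset.card_filter, ← Finset.univ_product_univ,
    Finset.sum_product]
  simp

theorem word_injective {n : ℕ} : Function.Injective (word (n := n)) := fun _ _ h =>
  Equiv.ext fun i => Fin.ext (congrFun (List.ofFn_injective h) i)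

theorem image_word (n : ℕ) :
    Finset.univ.image (word (n := n)) = (List.range n).permutations'.toFinset := by
  refine Finset.eq_of_subset_of_card_le ?_ ?_
  · intro l hl
    obtain ⟨π, -, rfl⟩ := Finset.mem_image.mp hl
    rw [List.mem_toFinset, List.mem_permutations', ← List.map_coe_finRange_eq_range,
      ← List.ofFn_eq_map]
    exact π.ofFn_comp_perm Fin.val
  · rw [Finset.card_image_of_injective _ word_injective, Finset.card_univ, Fintype.card_perm,
      Fintype.card_fin]
    refine (List.toFinset_card_le _).trans_eq ?_
    rw [← (List.permutations_perm_permutations' _).length_eq, List.length_permutations,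
      List.length_range]

theorem not_wordAscent_iff {n : ℕ} (π : Equiv.Perm (Fin n)) {i : ℕ} (hi : i + 1 < n) :
    ¬ wordAscent i (word π) ↔ DC.Descent π i := by
  have hne : π ⟨i + 1, hi⟩ ≠ π ⟨i, Nat.lt_of_succ_lt hi⟩ := by simp
  simp [wordAscent, word, DC.Descent, hi, Nat.lt_of_succ_lt hi, hne.le_iff_lt]

theorem schubert_card_eq (n B : ℕ) (hB : n.factorial ^ 3 < B) :
    (Finset.univ.filter (fun P : DC.Triple n =>
      DC.IsSchubert P ∧ ∀ i : ℕ, i + 1 < n →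
        (DC.Descent P.1 i ∨ DC.Descent P.2.1 i ∨ DC.Descent P.2.2 i))).card =
      inclExcl (fun l => B ^ inversions l) ((List.range (n - 1)).map wordAscent)
        (List.range n).permutations' / B ^ n.choose 2 % B := by
  set L := (List.range n).permutations'
  have hL : L.Nodup := (List.permutations_perm_permutations' _).nodup_iff.mp
    (List.nodup_permutations _ List.nodup_range)
  have hcard : L.toFinset.card = n.factorial := by
    rw [← image_word, Finset.card_image_of_injective _ word_injective, Finset.card_univ,
      Fintype.card_perm, Fintype.card_fin]
  rw [← sum_triples_eq_inclExcl _ _ _ hL]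
  simp only [← pow_add]
  rw [sum_pow_div_mod]
  · have himage : L.toFinset ×ˢ L.toFinset ×ˢ L.toFinset =
        Finset.univ.image (Prod.map (word (n := n))
          (Prod.map (word (n := n)) (word (n := n)))) := by
      rw [← Finset.univ_product_univ, ← Finset.univ_product_univ, Finset.prodMap_image_product,
        Finset.prodMap_image_product, image_word]
    rw [himage, Finset.filter_image, Finset.filter_image, Finset.card_image_of_injective _
      (word_injective.prodMap (word_injective.prodMap word_injective)), Finset.filter_filter]
    congr 1
    ext P
    rw [Finset.mem_filter, Finset.mem_filter]
    simp only [Finset.mem_univ, true_and, Prod.map_fst, Prod.map_snd,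
      inversions_word, DC.IsSchubert, ← add_assoc, List.forall_mem_map, List.mem_range]
    rw [and_comm]
    refine and_congr_left fun _ => forall_congr' fun i => ?_
    rw [Nat.lt_sub_iff_add_lt]
    refine forall_congr' fun hi => ?_
    rw [← not_wordAscent_iff _ hi, ← not_wordAscent_iff _ hi, ← not_wordAscent_iff _ hi]
    tauto
  · refine (Finset.card_filter_le _ _).trans_lt ?_
    rw [Finset.card_product, Finset.card_product, hcard]
    linarith [pow_three n.factorial]

/-- Exactly 2,351,475 Schubert problems for S_6 are not dc-trivial: at every position
at least one of the three permutations has a descent. -/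
theorem statement13 :
    (Finset.univ.filter (fun P : DC.Triple 6 =>
      DC.IsSchubert P ∧ ∀ i : ℕ, i + 1 < 6 →
        (DC.Descent P.1 i ∨ DC.Descent P.2.1 i ∨ DC.Descent P.2.2 i))).card = 2351475 := by
  rw [schubert_card_eq 6 (10 ^ 9) (by decide)]
  decide +kernel
end

section
/- Exactly 48 Schubert problems for S_6 are not dc-trivial and admit no descent-cycling move; that is, the number of triples (u,v,w) of permutations of {1,…,6} with ℓ(u)+ℓ(v)+ℓ(w)=15 such that no position i ∈ {1,…,5} has zero descents among u,v,w and no position i has exactly one descent among u,v,w, is exactly 48. -/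
namespace DC

/-- The coefficient of `X ^ k` in a sum of powers of `X` with fewer than `X` terms can be read off
as a base-`X` digit. -/
theorem sum_pow_div_mod {α : Type*} (S : Finset α) (f : α → ℕ) (X k : ℕ) (hX : S.card < X) :
    (∑ p ∈ S, X ^ f p) / X ^ k % X = (S.filter (fun p => f p = k)).card := by
  have hX0 : 0 < X := by omega
  have hlow : ∑ p ∈ S.filter (fun p => f p < k), X ^ f p < X ^ k := by
    rcases k with _ | k
    · simp
    · calc ∑ p ∈ S.filter (fun p => f p < k + 1), X ^ f p
          ≤ (S.filter (fun p => f p < k + 1)).card • X ^ k := by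
            refine Finset.sum_le_card_nsmul _ _ _ fun p hp => ?_
            exact Nat.pow_le_pow_right hX0 (Nat.lt_succ_iff.mp (Finset.mem_filter.mp hp).2)
        _ ≤ S.card * X ^ k := Nat.mul_le_mul_right _ (Finset.card_filter_le _ _)
        _ < X * X ^ k := Nat.mul_lt_mul_of_pos_right hX (pow_pos hX0 k)
        _ = X ^ (k + 1) := by ring
  obtain ⟨b, hb⟩ : X ^ (k + 1) ∣ ∑ p ∈ (S.filter (fun p => ¬ f p < k)).filter
      (fun p => ¬ f p = k), X ^ f p := by
    refine Finset.dvd_sum fun p hp => pow_dvd_pow _ ?_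
    simp only [Finset.mem_filter] at hp
    omega
  have hmid : ∑ p ∈ (S.filter (fun p => ¬ f p < k)).filter (fun p => f p = k), X ^ f p
      = (S.filter (fun p => f p = k)).card * X ^ k := by
    have hfilter : (S.filter (fun p => ¬ f p < k)).filter (fun p => f p = k)
        = S.filter (fun p => f p = k) := by
      ext p
      simp only [Finset.mem_filter]
      grind
    rw [hfilter, Finset.sum_congr rfl (g := fun _ => X ^ k)
      (fun p hp => by rw [(Finset.mem_filter.mp hp).2]), Finset.sum_const, smul_eq_mul]
  have hsum : ∑ p ∈ S, X ^ f p = ∑ p ∈ S.filter (fun p => f p < k), X ^ f p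
      + X ^ k * ((S.filter (fun p => f p = k)).card + X * b) := by
    rw [← Finset.sum_filter_add_sum_filter_not S (fun p => f p < k),
      ← Finset.sum_filter_add_sum_filter_not (S.filter (fun p => ¬ f p < k)) (fun p => f p = k),
      hmid, hb]
    ring
  rw [hsum, Nat.add_mul_div_left _ _ (pow_pos hX0 k), Nat.div_eq_of_lt hlow, zero_add,
    Nat.add_mul_mod_self_left, Nat.mod_eq_of_lt ((Finset.card_filter_le _ _).trans_lt hX)]

theorem len_le (π : Equiv.Perm (Fin 6)) : len π ≤ 15 :=
  (Finset.card_le_card (Finset.monotone_filter_right _ fun _ _ h => h.1)).trans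
    (show (Finset.univ.filter (fun p : Fin 6 × Fin 6 => p.1 < p.2)).card ≤ 15 by decide)

/-- The indicator (`0` or `1`) of `b < a`. -/
def inv (a b : Fin 6) : ℕ := (Nat.ble (b.val + 1) a.val).toNat

theorem inv_eq (a b : Fin 6) : inv a b = if b < a then 1 else 0 := by
  revert a b; decide

/-- The length of a permutation of six letters, written out. -/
theorem len_eq (π : Equiv.Perm (Fin 6)) :
    len π = inv (π 0) (π 1) + inv (π 0) (π 2) + inv (π 0) (π 3) + inv (π 0) (π 4)
      + inv (π 0) (π 5) + inv (π 1) (π 2) + inv (π 1) (π 3) + inv (π 1) (π 4) + inv (π 1) (π 5)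
      + inv (π 2) (π 3) + inv (π 2) (π 4) + inv (π 2) (π 5) + inv (π 3) (π 4) + inv (π 3) (π 5)
      + inv (π 4) (π 5) := by
  simp only [inv_eq]
  rw [len, Finset.card_filter, Fintype.sum_prod_type]
  simp only [Fin.sum_univ_six]
  simp
  ring

/-- The length and the descents of a permutation packed into one number: the length is the last
base-64 digit, and the descent indicators are base-4 digits above it. -/
def code (π : Equiv.Perm (Fin 6)) : ℕ :=
  len π + 64 * (inv (π 0) (π 1) + 4 * inv (π 1) (π 2) + 16 * inv (π 2) (π 3)
    + 64 * inv (π 3) (π 4) + 256 * inv (π 4) (π 5))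

/-- The number `(2 ^ 32) ^ code π`, in a form which evaluates quickly. -/
def weight (π : Equiv.Perm (Fin 6)) : ℕ :=
  1 <<< (32 *
    (inv (π 0) (π 1) + inv (π 0) (π 2) + inv (π 0) (π 3) + inv (π 0) (π 4)
      + inv (π 0) (π 5) + inv (π 1) (π 2) + inv (π 1) (π 3) + inv (π 1) (π 4) + inv (π 1) (π 5)
      + inv (π 2) (π 3) + inv (π 2) (π 4) + inv (π 2) (π 5) + inv (π 3) (π 4) + inv (π 3) (π 5)
      + inv (π 4) (π 5) + 64 * (inv (π 0) (π 1) + 4 * inv (π 1) (π 2) + 16 * inv (π 2) (π 3)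
      + 64 * inv (π 3) (π 4) + 256 * inv (π 4) (π 5))))

/-- The sums of three codes belonging to total length `15` and at least two descents at each
position. -/
def targets : Finset ℕ :=
  (({2, 3} : Finset ℕ) ×ˢ ({2, 3} : Finset ℕ) ×ˢ ({2, 3} : Finset ℕ) ×ˢ ({2, 3} : Finset ℕ)
    ×ˢ ({2, 3} : Finset ℕ)).image
    fun c => 15 + 64 * (c.1 + 4 * c.2.1 + 16 * c.2.2.1 + 64 * c.2.2.2.1 + 256 * c.2.2.2.2)

theorem sum_code :
    (∑ t ∈ targets, (∑ π : Equiv.Perm (Fin 6), (2 ^ 32) ^ code π) ^ 3 / (2 ^ 32) ^ t % 2 ^ 32)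
      = 48 := by
  have hcode : ∀ π : Equiv.Perm (Fin 6), (2 ^ 32) ^ code π = weight π := fun π => by
    rw [code, len_eq, weight, Nat.shiftLeft_eq, one_mul, ← pow_mul]
  simp only [hcode, ← pow_mul, ← Nat.shiftRight_eq_div_pow]
  decide +kernel

theorem sum_pow_cube {α : Type*} [Fintype α] (f : α → ℕ) (X : ℕ) :
    (∑ a, X ^ f a) ^ 3 = ∑ P : α × α × α, X ^ (f P.1 + f P.2.1 + f P.2.2) := by
  simp only [pow_three, pow_add, Fintype.sum_prod_type, mul_assoc, ← Finset.mul_sum,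
    ← Finset.sum_mul]

/-- The number of triples with a given sum of codes, read off from the cube of the generating
function of the codes. -/
theorem card_code (X t : ℕ) (hX : Fintype.card (Triple 6) < X) :
    (Finset.univ.filter fun P : Triple 6 => code P.1 + code P.2.1 + code P.2.2 = t).card
      = (∑ π : Equiv.Perm (Fin 6), X ^ code π) ^ 3 / X ^ t % X := by
  rw [sum_pow_cube, ← sum_pow_div_mod _ _ X _ hX]

theorem card_filter_mem {α β : Type*} [Fintype α] [DecidableEq β] (f : α → β) (T : Finset β) :
    (Finset.univ.filter fun a => f a ∈ T).card
      = ∑ t ∈ T, (Finset.univ.filter fun a => f a = t).card := by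
  rw [Finset.card_eq_sum_card_fiberwise (f := f) (t := T) (by intro a ha; simpa using ha)]
  refine Finset.sum_congr rfl fun t ht => ?_
  rw [Finset.filter_filter]
  refine congrArg Finset.card (Finset.filter_congr fun a _ => ?_)
  exact ⟨fun h => h.2, fun h => ⟨by rwa [h], h⟩⟩

theorem card_targets :
    (Finset.univ.filter fun P : Triple 6 =>
      code P.1 + code P.2.1 + code P.2.2 ∈ targets).card = 48 := by
  rw [card_filter_mem (fun P : Triple 6 => code P.1 + code P.2.1 + code P.2.2), ← sum_code]
  refine Finset.sum_congr rfl fun t _ => ?_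
  exact card_code (2 ^ 32) t (by simp [Fintype.card_perm, Nat.factorial])

theorem mem_targets (l a b c d e : ℕ) (hl : l ≤ 45) (ha : a ≤ 3) (hb : b ≤ 3) (hc : c ≤ 3)
    (hd : d ≤ 3) (he : e ≤ 3) :
    l + 64 * (a + 4 * b + 16 * c + 64 * d + 256 * e) ∈ targets ↔
      l = 15 ∧ 2 ≤ a ∧ 2 ≤ b ∧ 2 ≤ c ∧ 2 ≤ d ∧ 2 ≤ e := by
  simp only [targets, Finset.mem_image, Finset.mem_product, Prod.exists, Finset.mem_insert,
    Finset.mem_singleton]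
  constructor
  · rintro ⟨a', b', c', d', e', ⟨ha', hb', hc', hd', he'⟩, h⟩
    omega
  · rintro ⟨rfl, h⟩
    exact ⟨a, b, c, d, e, by omega, rfl⟩

theorem inv_le_one (a b : Fin 6) : inv a b ≤ 1 := Bool.toNat_le _

theorem descent_iff (π : Equiv.Perm (Fin 6)) (i : ℕ) (h : i + 1 < 6) :
    Descent π i ↔ inv (π ⟨i, Nat.lt_of_succ_lt h⟩) (π ⟨i + 1, h⟩) = 1 := by
  simp [Descent, h, inv_eq]

theorem descents_iff (P : Triple 6) (i : ℕ) (h : i + 1 < 6) :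
    (¬ (¬ Descent P.1 i ∧ ¬ Descent P.2.1 i ∧ ¬ Descent P.2.2 i) ∧
      ¬ ((Descent P.1 i ∧ ¬ Descent P.2.1 i ∧ ¬ Descent P.2.2 i) ∨
        (¬ Descent P.1 i ∧ Descent P.2.1 i ∧ ¬ Descent P.2.2 i) ∨
        (¬ Descent P.1 i ∧ ¬ Descent P.2.1 i ∧ Descent P.2.2 i))) ↔
      2 ≤ inv (P.1 ⟨i, Nat.lt_of_succ_lt h⟩) (P.1 ⟨i + 1, h⟩)
        + inv (P.2.1 ⟨i, Nat.lt_of_succ_lt h⟩) (P.2.1 ⟨i + 1, h⟩)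
        + inv (P.2.2 ⟨i, Nat.lt_of_succ_lt h⟩) (P.2.2 ⟨i + 1, h⟩) := by
  rw [descent_iff _ i h, descent_iff _ i h, descent_iff _ i h]
  have h₁ := inv_le_one (P.1 ⟨i, Nat.lt_of_succ_lt h⟩) (P.1 ⟨i + 1, h⟩)
  have h₂ := inv_le_one (P.2.1 ⟨i, Nat.lt_of_succ_lt h⟩) (P.2.1 ⟨i + 1, h⟩)
  have h₃ := inv_le_one (P.2.2 ⟨i, Nat.lt_of_succ_lt h⟩) (P.2.2 ⟨i + 1, h⟩)
  omega

theorem forall_lt_six {p : ∀ i : ℕ, i + 1 < 6 → Prop} :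
    (∀ i h, p i h) ↔ p 0 (by decide) ∧ p 1 (by decide) ∧ p 2 (by decide) ∧ p 3 (by decide)
      ∧ p 4 (by decide) := by
  refine ⟨fun h => ⟨h _ _, h _ _, h _ _, h _ _, h _ _⟩, ?_⟩
  rintro ⟨h0, h1, h2, h3, h4⟩ i hi
  have : i < 5 := by omega
  interval_cases i <;> assumption

theorem code_mem_targets_iff (P : Triple 6) :
    code P.1 + code P.2.1 + code P.2.2 ∈ targets ↔ IsSchubert P ∧ ∀ i : ℕ, ∀ h : i + 1 < 6,
      2 ≤ inv (P.1 ⟨i, Nat.lt_of_succ_lt h⟩) (P.1 ⟨i + 1, h⟩)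
        + inv (P.2.1 ⟨i, Nat.lt_of_succ_lt h⟩) (P.2.1 ⟨i + 1, h⟩)
        + inv (P.2.2 ⟨i, Nat.lt_of_succ_lt h⟩) (P.2.2 ⟨i + 1, h⟩) := by
  let d (a b : Fin 6) : ℕ :=
    inv (P.1 a) (P.1 b) + inv (P.2.1 a) (P.2.1 b) + inv (P.2.2 a) (P.2.2 b)
  have hd (a b : Fin 6) : d a b ≤ 3 :=
    Nat.add_le_add (Nat.add_le_add (inv_le_one _ _) (inv_le_one _ _)) (inv_le_one _ _)
  have hl : len P.1 + len P.2.1 + len P.2.2 ≤ 45 :=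
    Nat.add_le_add (Nat.add_le_add (len_le _) (len_le _)) (len_le _)
  have hcode : code P.1 + code P.2.1 + code P.2.2 = len P.1 + len P.2.1 + len P.2.2
      + 64 * (d 0 1 + 4 * d 1 2 + 16 * d 2 3 + 64 * d 3 4 + 256 * d 4 5) := by
    simp only [code, d]
    ring
  rw [hcode, mem_targets _ _ _ _ _ _ hl (hd _ _) (hd _ _) (hd _ _) (hd _ _) (hd _ _),
    forall_lt_six]
  rfl

end DC

open scoped Classical

/-- Exactly 48 Schubert problems for S_6 are not dc-trivial and admit no
descent-cycling move: no position has zero descents among u,v,w, and no position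
has exactly one descent among u,v,w. -/
theorem statement16 :
    (Finset.univ.filter (fun P : DC.Triple 6 =>
      DC.IsSchubert P ∧ ∀ i : ℕ, i + 1 < 6 →
        (¬ (¬ DC.Descent P.1 i ∧ ¬ DC.Descent P.2.1 i ∧ ¬ DC.Descent P.2.2 i) ∧
         ¬ ((DC.Descent P.1 i ∧ ¬ DC.Descent P.2.1 i ∧ ¬ DC.Descent P.2.2 i) ∨
            (¬ DC.Descent P.1 i ∧ DC.Descent P.2.1 i ∧ ¬ DC.Descent P.2.2 i) ∨
            (¬ DC.Descent P.1 i ∧ ¬ DC.Descent P.2.1 i ∧ DC.Descent P.2.2 i))))).card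
      = 48 := by
  rw [← DC.card_targets]
  refine congrArg Finset.card (Finset.filter_congr fun P _ => ?_)
  rw [DC.code_mem_targets_iff]
  exact and_congr_right' (forall₂_congr fun i h => DC.descents_iff P i h)
end
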